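/- arXiv:2504.16469 — 2 statements merged into one kernel-verified Lean document; each statement's English description precedes it below -/
import Mathlib

section
/- Let a ≥ 0 and b be real numbers with 0 < b < (a − 1)² (in particular a ≠ 1), set D(a,b) = a⁴ + (b − 1)² − 2a²(1 + b), and let N be a natural number. Then ( (1/(2π)) ∫₀^{2π} ((a + cos ψ)² + (sin ψ)²) / ((a + cos ψ)² + (sin ψ)² − b) dψ )^N = ( 1 + b/√(D(a,b)) )^N. -/
open Real

theorem add_mul_cos_pos {p q : ℝ} (hq : |q| < p) (x : ℝ) : 0 < p + q * cos x := by
  have hqc : |q * cos x| ≤ |q| := by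
    rw [abs_mul]
    exact mul_le_of_le_one_right (abs_nonneg q) (abs_cos_le_one x)
  linarith [neg_abs_le (q * cos x)]

/-- An antiderivative of `1 / (p + q cos x)`, for `|q| < p`, that is smooth on the whole line. -/
theorem hasDerivAt_sub_arctan_div {p q s : ℝ} (hq : |q| < p) (hs : 0 < s)
    (hsq : s ^ 2 = p ^ 2 - q ^ 2) (x : ℝ) :
    HasDerivAt (fun x => (x - 2 * arctan (q * sin x / (p + s + q * cos x))) / s)
      (1 / (p + q * cos x)) x := by
  have hden := add_mul_cos_pos hq x
  have hp : 0 < p := (abs_nonneg q).trans_lt hq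
  have hc : 0 < p + s + q * cos x := by linarith
  have h_quot := ((hasDerivAt_sin x).const_mul q).div
    (((hasDerivAt_cos x).const_mul q).const_add (p + s)) hc.ne'
  refine (((hasDerivAt_id x).sub (h_quot.arctan.const_mul 2)).div_const s).congr_deriv ?_
  have hsum : (p + s + q * cos x) ^ 2 + (q * sin x) ^ 2 = 2 * (p + s) * (p + q * cos x) := by
    linear_combination q ^ 2 * sin_sq_add_cos_sq x + hsq
  have harctan : 1 + (q * sin x / (p + s + q * cos x)) ^ 2
      = 2 * (p + s) * (p + q * cos x) / (p + s + q * cos x) ^ 2 := by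
    rw [← hsum]
    field_simp
  have hnum : q * cos x * (p + s + q * cos x) - q * sin x * (q * -sin x)
      = (p + s) * (p + q * cos x - s) := by
    linear_combination q ^ 2 * sin_sq_add_cos_sq x + hsq
  have hps : 0 < p + s := by positivity
  rw [Pi.div_apply, harctan, hnum]
  field_simp
  ring

theorem integral_one_div_add_mul_cos {p q : ℝ} (hq : |q| < p) :
    ∫ x in (0 : ℝ)..(2 * π), 1 / (p + q * cos x) = 2 * π / √(p ^ 2 - q ^ 2) := by
  have hpos : 0 < p ^ 2 - q ^ 2 :=
    sub_pos.mpr (sq_lt_sq.mpr (hq.trans_le (le_abs_self p)))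
  have hcont : Continuous fun x => 1 / (p + q * cos x) :=
    continuous_const.div (by fun_prop) fun x => (add_mul_cos_pos hq x).ne'
  rw [intervalIntegral.integral_eq_sub_of_hasDerivAt
    (fun x _ => hasDerivAt_sub_arctan_div hq (sqrt_pos.mpr hpos) (sq_sqrt hpos.le) x)
    (hcont.intervalIntegrable _ _)]
  simp

/-- Closed form (Eq. (19)) for the Laplace transform of the aggregated reflected signal power
for `N` RISs placed uniformly on a circle (BPP) with Rayleigh fading:
`((1/(2π)) ∫₀^{2π} A(ψ)/(A(ψ) − b) dψ)^N = (1 + b/√D)^N`, with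
`A(ψ) = (a+cosψ)²+(sinψ)²` and `D = a⁴+(b−1)²−2a²(1+b)`. -/
theorem bpp_rayleigh_laplace_closed_form
    (a b D : ℝ) (ha : 0 ≤ a) (hb : 0 < b) (hab : b < (a - 1) ^ 2)
    (hD : D = a ^ 4 + (b - 1) ^ 2 - 2 * a ^ 2 * (1 + b)) (N : ℕ) :
    ((1 / (2 * π)) *
        ∫ ψ in (0 : ℝ)..(2 * π),
          ((a + Real.cos ψ) ^ 2 + (Real.sin ψ) ^ 2) /
            ((a + Real.cos ψ) ^ 2 + (Real.sin ψ) ^ 2 - b)) ^ N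
      = (1 + b / Real.sqrt D) ^ N := by
  have hq : |2 * a| < a ^ 2 + 1 - b := by
    rw [abs_of_nonneg (by positivity)]
    linarith
  have hden := add_mul_cos_pos hq
  have hcont : Continuous fun ψ => 1 / (a ^ 2 + 1 - b + 2 * a * cos ψ) :=
    continuous_const.div (by fun_prop) fun ψ => (hden ψ).ne'
  have hsplit (ψ : ℝ) : ((a + cos ψ) ^ 2 + sin ψ ^ 2) / ((a + cos ψ) ^ 2 + sin ψ ^ 2 - b)
      = 1 + b * (1 / (a ^ 2 + 1 - b + 2 * a * cos ψ)) := by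
    have hsq : (a + cos ψ) ^ 2 + sin ψ ^ 2 = a ^ 2 + 1 - b + 2 * a * cos ψ + b := by
      linear_combination sin_sq_add_cos_sq ψ
    rw [hsq, add_sub_cancel_right, add_div, div_self (hden ψ).ne', mul_one_div]
  have hdisc : (a ^ 2 + 1 - b) ^ 2 - (2 * a) ^ 2 = D := by
    rw [hD]
    ring
  congr 1
  simp_rw [hsplit]
  rw [intervalIntegral.integral_add intervalIntegrable_const
      ((hcont.const_mul b).intervalIntegrable _ _),
    intervalIntegral.integral_const_mul, integral_one_div_add_mul_cos hq, hdisc,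
    intervalIntegral.integral_const, smul_eq_mul]
  field_simp
  ring
end

section
/- Let a ≥ 0 and b be real numbers with 0 < b < (a − 1)² (in particular a ≠ 1), and set D(a,b) = a⁴ + (b − 1)² − 2a²(1 + b). Then (1/(2π)) ∫₀^{2π} ( b / ((a + cos ψ)² + (sin ψ)² − b) )² dψ = b²(a² + 1 − b) / D(a,b)^{3/2}. -/
open Real

lemma add_mul_cos_pos_s7 {A B : ℝ} (h : |B| < A) (x : ℝ) : 0 < A + B * cos x := by
  have h1 : |B * cos x| ≤ |B| := by
    rw [abs_mul]
    exact mul_le_of_le_one_right (abs_nonneg B) (abs_cos_le_one x)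
  linarith [neg_abs_le (B * cos x)]

/-- A globally smooth antiderivative of `s / (A + B cos x)`, where `s = √(A² - B²)`. -/
lemma hasDerivAt_sub_two_mul_arctan {A B s : ℝ} (h : |B| < A) (hs : 0 < s)
    (hsq : s ^ 2 = A ^ 2 - B ^ 2) (x : ℝ) :
    HasDerivAt (fun y => y - 2 * arctan (B * sin y / (A + s + B * cos y)))
      (s / (A + B * cos x)) x := by
  have hp := add_mul_cos_pos_s7 h x
  have hA : 0 < A := (abs_nonneg B).trans_lt h
  have hN : A + s + B * cos x ≠ 0 := by linarith
  have hq := (((hasDerivAt_sin x).const_mul B).div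
    (((hasDerivAt_cos x).const_mul B).const_add (A + s)) hN).arctan.const_mul 2
  refine ((hasDerivAt_id x).sub hq).congr_deriv ?_
  have hsin : sin x ^ 2 = 1 - cos x ^ 2 := sin_sq x
  have hden : (A + s + B * cos x) ^ 2 + (B * sin x) ^ 2 = 2 * (A + s) * (A + B * cos x) := by
    linear_combination B ^ 2 * hsin + hsq
  have hinner : 1 / (1 + (B * sin x / (A + s + B * cos x)) ^ 2) *
      ((B * cos x * (A + s + B * cos x) - B * sin x * (B * -sin x)) / (A + s + B * cos x) ^ 2)
      = (B * cos x * (A + s) + B ^ 2) / (2 * (A + s) * (A + B * cos x)) := by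
    rw [← hden]
    have hd : (A + s + B * cos x) ^ 2 + (B * sin x) ^ 2 ≠ 0 := by positivity
    have hone : 1 + (B * sin x / (A + s + B * cos x)) ^ 2 =
        ((A + s + B * cos x) ^ 2 + (B * sin x) ^ 2) / (A + s + B * cos x) ^ 2 := by
      field_simp
    rw [hone, one_div_div, mul_comm, div_mul_div_cancel₀ (pow_ne_zero 2 hN)]
    congr 1
    linear_combination B ^ 2 * hsin
  have hAs : A + s ≠ 0 := by positivity
  rw [Pi.div_apply, hinner]
  field_simp
  linear_combination -hsq

lemma hasDerivAt_sin_div_add_mul_cos {A B : ℝ} (h : |B| < A) (x : ℝ) :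
    HasDerivAt (fun y => sin y / (A + B * cos y))
      ((A * cos x + B) / (A + B * cos x) ^ 2) x := by
  have hp := add_mul_cos_pos_s7 h x
  refine ((hasDerivAt_sin x).div
    (((hasDerivAt_cos x).const_mul B).const_add A) hp.ne').congr_deriv ?_
  congr 1
  linear_combination B * sin_sq x

/-- `∫₀^{2π} dx / (A + B cos x)² = 2πA / s³` for `|B| < A` and `s = √(A² - B²)`. -/
lemma integral_inv_add_mul_cos_sq {A B s : ℝ} (h : |B| < A) (hs : 0 < s)
    (hsq : s ^ 2 = A ^ 2 - B ^ 2) :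
    ∫ x in (0 : ℝ)..(2 * π), ((A + B * cos x) ^ 2)⁻¹ = 2 * π * A / s ^ 3 := by
  have hderiv (x : ℝ) : HasDerivAt
      (fun y => A / s ^ 3 * (y - 2 * arctan (B * sin y / (A + s + B * cos y)))
        - B / s ^ 2 * (sin y / (A + B * cos y))) ((A + B * cos x) ^ 2)⁻¹ x := by
    have hp := add_mul_cos_pos_s7 h x
    refine (((hasDerivAt_sub_two_mul_arctan h hs hsq x).const_mul (A / s ^ 3)).sub
      ((hasDerivAt_sin_div_add_mul_cos h x).const_mul (B / s ^ 2))).congr_deriv ?_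
    field_simp
    linear_combination -hsq
  have hcont : Continuous fun x => ((A + B * cos x) ^ 2)⁻¹ :=
    Continuous.inv₀ (by fun_prop) fun x => (pow_pos (add_mul_cos_pos_s7 h x) 2).ne'
  rw [intervalIntegral.integral_eq_sub_of_hasDerivAt (fun x _ => hderiv x)
    (hcont.intervalIntegrable _ _)]
  simp
  ring



/-- Intermediate second-order integral identity:
`(1/(2π)) ∫₀^{2π} (b/((a+cosψ)²+(sinψ)² − b))² dψ = b²(a²+1−b)/D^{3/2}`. -/
theorem second_order_circle_integral
    (a b D : ℝ) (ha : 0 ≤ a) (hb : 0 < b) (hab : b < (a - 1) ^ 2)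
    (hD : D = a ^ 4 + (b - 1) ^ 2 - 2 * a ^ 2 * (1 + b)) :
    (1 / (2 * π)) *
        (∫ ψ in (0 : ℝ)..(2 * π),
          (b / ((a + Real.cos ψ) ^ 2 + (Real.sin ψ) ^ 2 - b)) ^ 2)
      = b ^ 2 * (a ^ 2 + 1 - b) / D ^ ((3 : ℝ) / 2) := by
  have hBA : |2 * a| < a ^ 2 + 1 - b := by
    rw [abs_of_nonneg (by positivity)]
    linarith
  have hDsq : D = (a ^ 2 + 1 - b) ^ 2 - (2 * a) ^ 2 := by rw [hD]; ring
  have hDpos : 0 < D := by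
    rw [hDsq, sub_pos]
    exact sq_lt_sq' (by linarith [neg_abs_le (2 * a)]) ((le_abs_self _).trans_lt hBA)
  have hpow : D ^ ((3 : ℝ) / 2) = √D ^ 3 := by
    rw [sqrt_eq_rpow, ← rpow_natCast, ← rpow_mul hDpos.le]
    norm_num
  have hint (ψ : ℝ) : (b / ((a + cos ψ) ^ 2 + sin ψ ^ 2 - b)) ^ 2
      = b ^ 2 * ((a ^ 2 + 1 - b + 2 * a * cos ψ) ^ 2)⁻¹ := by
    rw [div_pow, div_eq_mul_inv, sin_sq]
    ring_nf
  have hs : 0 < √D := sqrt_pos.2 hDpos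
  simp_rw [hint]
  rw [intervalIntegral.integral_const_mul,
    integral_inv_add_mul_cos_sq hBA hs ((sq_sqrt hDpos.le).trans hDsq), hpow]
  field_simp
end
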